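/- arXiv:2412.19546 — 2 statements merged into one kernel-verified Lean document; each statement's English description precedes it below -/
import Mathlib

section
/- Let (Ω, F) be a measurable space, let v_1, …, v_n be binary capacities on (Ω, F), let C = {A ∈ F : A = ⋃_{i=1}^n A_i for some A_i ∈ F with v_i(A_i) = 0 for each i}, and let X : Ω → ℝ be bounded and F-measurable. Assume Ω ∉ C and that C is closed from below (for every increasing sequence (A_j)_{j∈ℕ} in C, ⋃_j A_j ∈ C), and set x* = inf{x ∈ ℝ : {X > x} ∈ C} (a real number). Then there exists a measurable partition (A_1*, …, A_n*) of Ω (pairwise disjoint sets in F with union Ω) such that A_i* ∩ {X > x*} ∈ C_{v_i} for each i ∈ {1,…,n}; and for any such partition, the allocation X_i* = (X − x*)·1_{A_i*} + x*/n, i ∈ {1,…,n}, satisfies ∑_{i=1}^n I_{v_i}(X_i*) = x*, so it attains the inf-convolution of I_{v_1}, …, I_{v_n} at X. -/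
open MeasureTheory Set

/-- A capacity on a measurable space: `w ∅ = 0`, `w Ω = 1`, and `w` is monotone
on measurable sets. -/
def IsCapacity {Ω : Type*} [MeasurableSpace Ω] (w : Set Ω → ℝ) : Prop :=
  w ∅ = 0 ∧ w Set.univ = 1 ∧
    ∀ ⦃A B : Set Ω⦄, MeasurableSet A → MeasurableSet B → A ⊆ B → w A ≤ w B

/-- A binary capacity takes only the values 0 and 1 on measurable sets. -/
def IsBinaryCapacity {Ω : Type*} [MeasurableSpace Ω] (w : Set Ω → ℝ) : Prop :=
  IsCapacity w ∧ ∀ A : Set Ω, MeasurableSet A → w A = 0 ∨ w A = 1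

/-- The Choquet quantile `I_v (X) = inf {x | v {ω | X ω ≥ x} = 0}`. -/
noncomputable def choquetQuantile {Ω : Type*} [MeasurableSpace Ω]
    (v : Set Ω → ℝ) (X : Ω → ℝ) : ℝ :=
  sInf {x : ℝ | v {ω | x ≤ X ω} = 0}

theorem sum_indicator_of_partition {Ω : Type*} {n : ℕ} {As : Fin n → Set Ω}
    (hdisj : Pairwise (Function.onFun Disjoint As)) (hU : (⋃ i, As i) = Set.univ)
    (f : Ω → ℝ) (ω : Ω) : ∑ i, (As i).indicator f ω = f ω := by
  obtain ⟨j, hj⟩ := mem_iUnion.1 (hU ▸ mem_univ ω)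
  rw [Finset.sum_eq_single j]
  · exact indicator_of_mem hj f
  · exact fun i _ hij => indicator_of_notMem (fun hi => (hdisj hij).notMem_of_mem_left hi hj) f
  · simp

theorem abs_indicator_sub_add_le {Ω : Type*} {X : Ω → ℝ} {M : ℝ} (hM : ∀ ω, |X ω| ≤ M) (A : Set Ω)
    (a b : ℝ) (ω : Ω) : |A.indicator (fun ω' => X ω' - a) ω + b| ≤ M + |a| + |b| := by
  refine (abs_add_le _ _).trans (add_le_add_left ?_ _)
  by_cases h : ω ∈ A
  · rw [indicator_of_mem h]
    exact (abs_sub _ _).trans (add_le_add_left (hM ω) _)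
  · rw [indicator_of_notMem h, abs_zero]
    exact add_nonneg ((abs_nonneg _).trans (hM ω)) (abs_nonneg _)

section ChoquetQuantile

variable {Ω : Type*} [MeasurableSpace Ω]

/-- Measurable subsets of null sets of a binary capacity are null. -/
theorem IsBinaryCapacity.null_of_subset {w : Set Ω → ℝ} (hw : IsBinaryCapacity w) {A B : Set Ω}
    (hA : MeasurableSet A) (hB : MeasurableSet B) (hAB : A ⊆ B) (h : w B = 0) : w A = 0 := by
  rcases hw.2 A hA with h' | h'
  · exact h'
  · have := hw.1.2.2 hA hB hAB
    linarith

theorem IsBinaryCapacity.bddBelow_quantileSet {w : Set Ω → ℝ} (hw : IsBinaryCapacity w)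
    {Y : Ω → ℝ} {M : ℝ} (hM : ∀ ω, |Y ω| ≤ M) : BddBelow {x : ℝ | w {ω | x ≤ Y ω} = 0} := by
  refine ⟨-M, fun x hx => ?_⟩
  by_contra! hlt
  have huniv : {ω | x ≤ Y ω} = Set.univ :=
    eq_univ_of_forall fun ω => by
      have := (abs_le.1 (hM ω)).1
      simp only [mem_ofPred_eq]
      linarith
  rw [mem_ofPred_eq, huniv, hw.1.2.1] at hx
  exact one_ne_zero hx

/-- Upper level sets strictly above the Choquet quantile are null. -/
theorem IsBinaryCapacity.null_of_choquetQuantile_lt {w : Set Ω → ℝ} (hw : IsBinaryCapacity w)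
    {Y : Ω → ℝ} (hY : Measurable Y) {M : ℝ} (hM : ∀ ω, |Y ω| ≤ M) {y : ℝ}
    (hy : choquetQuantile w Y < y) : w {ω | y ≤ Y ω} = 0 := by
  have hne : {x : ℝ | w {ω | x ≤ Y ω} = 0}.Nonempty := by
    refine ⟨M + 1, ?_⟩
    have hempty : {ω | M + 1 ≤ Y ω} = ∅ :=
      eq_empty_of_forall_notMem fun ω hω => by
        have := (abs_le.1 (hM ω)).2
        simp only [mem_ofPred_eq] at hω
        linarith
    rw [mem_ofPred_eq, hempty, hw.1.1]
  obtain ⟨x, hx, hxy⟩ := exists_lt_of_csInf_lt hne hy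
  exact hw.null_of_subset (measurableSet_le measurable_const hY)
    (measurableSet_le measurable_const hY) (fun ω hω => hxy.le.trans hω) hx

/-- A bound on the Choquet quantile from nullity of all higher upper level sets. -/
theorem IsBinaryCapacity.choquetQuantile_le {w : Set Ω → ℝ} (hw : IsBinaryCapacity w)
    {Y : Ω → ℝ} {M : ℝ} (hM : ∀ ω, |Y ω| ≤ M) {a : ℝ}
    (h : ∀ x, a < x → w {ω | x ≤ Y ω} = 0) : choquetQuantile w Y ≤ a :=
  le_of_forall_gt_imp_ge_of_dense fun x hx =>
    csInf_le (hw.bddBelow_quantileSet hM) (h x hx)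

/-- The unions of null sets, one for each of a finite family of set functions. -/
def nullUnions {n : ℕ} (v : Fin n → Set Ω → ℝ) : Set (Set Ω) :=
  {A : Set Ω | ∃ As : Fin n → Set Ω,
    (∀ i, MeasurableSet (As i)) ∧ (∀ i, v i (As i) = 0) ∧ A = ⋃ i, As i}

variable {n : ℕ} {v : Fin n → Set Ω → ℝ}

theorem mem_nullUnions_of_subset (hv : ∀ i, IsBinaryCapacity (v i)) {A B : Set Ω}
    (hA : MeasurableSet A) (hAB : A ⊆ B) (hB : B ∈ nullUnions v) : A ∈ nullUnions v := by
  obtain ⟨Bs, hBm, hB0, rfl⟩ := hB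
  refine ⟨fun i => A ∩ Bs i, fun i => hA.inter (hBm i), fun i => ?_, ?_⟩
  · exact (hv i).null_of_subset (hA.inter (hBm i)) (hBm i) inter_subset_right (hB0 i)
  · rw [← inter_iUnion, inter_eq_left.2 hAB]

theorem bddBelow_nullUnions_levels (huniv : Set.univ ∉ nullUnions v) {X : Ω → ℝ} {M : ℝ}
    (hM : ∀ ω, |X ω| ≤ M) : BddBelow {x : ℝ | {ω | x < X ω} ∈ nullUnions v} := by
  refine ⟨-M, fun x hx => ?_⟩
  by_contra! hlt
  refine huniv ?_
  have h : {ω | x < X ω} = Set.univ :=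
    eq_univ_of_forall fun ω => hlt.trans_le (abs_le.1 (hM ω)).1
  rwa [mem_ofPred_eq, h] at hx

/-- If unions of null sets are closed from below, the strict upper level set at the critical
level is itself such a union. -/
theorem level_sInf_mem_nullUnions (hv : ∀ i, IsBinaryCapacity (v i))
    (hclosed : ∀ A : ℕ → Set Ω, (∀ j, A j ∈ nullUnions v) → Monotone A →
      (⋃ j, A j) ∈ nullUnions v)
    {X : Ω → ℝ} (hX : Measurable X) {M : ℝ} (hM : ∀ ω, |X ω| ≤ M) :
    {ω | sInf {x : ℝ | {ω | x < X ω} ∈ nullUnions v} < X ω} ∈ nullUnions v := by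
  set a := sInf {x : ℝ | {ω | x < X ω} ∈ nullUnions v} with ha
  have hne : {x : ℝ | {ω | x < X ω} ∈ nullUnions v}.Nonempty := by
    refine ⟨M, fun _ => ∅, fun _ => MeasurableSet.empty, fun i => (hv i).1.1, ?_⟩
    rw [iUnion_empty]
    exact eq_empty_of_forall_notMem fun ω hω => (abs_le.1 (hM ω)).2.not_gt hω
  have hmem : ∀ y, a < y → {ω | y < X ω} ∈ nullUnions v := fun y hy => by
    obtain ⟨x, hx, hxy⟩ := exists_lt_of_csInf_lt hne hy
    exact mem_nullUnions_of_subset hv (measurableSet_lt measurable_const hX)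
      (fun ω hω => hxy.trans hω) hx
  have hU : {ω | a < X ω} = ⋃ j : ℕ, {ω | a + 1 / ((j : ℝ) + 1) < X ω} := by
    ext ω
    simp only [mem_ofPred_eq, mem_iUnion]
    constructor
    · intro h
      obtain ⟨j, hj⟩ := exists_nat_one_div_lt (sub_pos.2 h)
      exact ⟨j, by linarith⟩
    · rintro ⟨j, hj⟩
      have : 0 < 1 / ((j : ℝ) + 1) := Nat.one_div_pos_of_nat
      linarith
  rw [hU]
  refine hclosed _ (fun j => hmem _ (lt_add_of_pos_right _ Nat.one_div_pos_of_nat)) ?_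
  intro j k hjk ω hω
  have : 1 / ((k : ℝ) + 1) ≤ 1 / ((j : ℝ) + 1) := Nat.one_div_le_one_div hjk
  simp only [mem_ofPred_eq] at hω ⊢
  linarith

/-- A union of null sets can be carved out by a measurable partition of the whole space. -/
theorem exists_partition_of_mem_nullUnions (hv : ∀ i, IsBinaryCapacity (v i)) (hn : 0 < n)
    {B : Set Ω} (hB : B ∈ nullUnions v) :
    ∃ As : Fin n → Set Ω, (∀ i, MeasurableSet (As i)) ∧
      Pairwise (Function.onFun Disjoint As) ∧ (⋃ i, As i) = Set.univ ∧
      ∀ i, v i (As i ∩ B) = 0 := by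
  obtain ⟨Bs, hBm, hB0, rfl⟩ := hB
  have hUm : MeasurableSet (⋃ i, Bs i) := MeasurableSet.iUnion hBm
  have hfm : ∀ i, MeasurableSet (disjointed Bs i) := fun i =>
    disjointedRec (p := MeasurableSet) (fun {_ _} h => h.diff (hBm _)) (hBm i)
  have hsub : ∀ i, disjointed Bs i ⊆ ⋃ i, Bs i := fun i =>
    (disjointed_subset Bs i).trans (subset_iUnion Bs i)
  let i₀ : Fin n := ⟨0, hn⟩
  let R : Fin n → Set Ω := fun i => if i = i₀ then (⋃ i, Bs i)ᶜ else ∅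
  have hRm : ∀ i, MeasurableSet (R i) := fun i => by
    by_cases h : i = i₀ <;> simp only [R, h, if_true, if_false]
    exacts [hUm.compl, MeasurableSet.empty]
  have hRsub : ∀ i, R i ⊆ (⋃ i, Bs i)ᶜ := fun i => by
    by_cases h : i = i₀ <;> simp only [R, h, if_true, if_false]
    exacts [subset_rfl, empty_subset _]
  refine ⟨fun i => disjointed Bs i ∪ R i, fun i => (hfm i).union (hRm i), ?_, ?_, fun i => ?_⟩
  · intro i j hij
    have h1 : ∀ k l, Disjoint (disjointed Bs k) (R l) := fun k l =>
      disjoint_compl_right.mono (hsub k) (hRsub l)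
    have h2 : Disjoint (R i) (R j) := by
      by_cases h : i = i₀
      · have : j ≠ i₀ := fun h' => hij (h.trans h'.symm)
        simp [R, this]
      · simp [R, h]
    exact ((disjoint_disjointed Bs hij).union_right (h1 i j)).union_left
      ((h1 j i).symm.union_right h2)
  · rw [iUnion_union_distrib, iUnion_disjointed]
    refine eq_univ_of_forall fun ω => ?_
    by_cases h : ω ∈ ⋃ i, Bs i
    · exact Or.inl h
    · exact Or.inr (mem_iUnion.2 ⟨i₀, by simpa [R] using h⟩)
  · refine (hv i).null_of_subset (((hfm i).union (hRm i)).inter hUm) (hBm i) ?_ (hB0 i)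
    rintro ω ⟨h | h, hω⟩
    · exact disjointed_subset Bs i h
    · exact absurd hω (hRsub i h)

/-- Every allocation has total Choquet quantile at least the critical level. -/
theorem sInf_level_le_sum_choquetQuantile (hv : ∀ i, IsBinaryCapacity (v i)) (hn : 0 < n)
    (huniv : Set.univ ∉ nullUnions v) {X : Ω → ℝ} (hX : Measurable X)
    {M : ℝ} (hM : ∀ ω, |X ω| ≤ M) {Y : Fin n → Ω → ℝ} (hY : ∀ i, Measurable (Y i))
    (hYb : ∀ i, ∃ M : ℝ, ∀ ω, |Y i ω| ≤ M) (hsum : ∀ ω, ∑ i, Y i ω = X ω) :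
    sInf {x : ℝ | {ω | x < X ω} ∈ nullUnions v} ≤ ∑ i, choquetQuantile (v i) (Y i) := by
  have hn' : (0 : ℝ) < n := Nat.cast_pos.2 hn
  refine le_of_forall_pos_le_add fun ε hε => ?_
  let y : Fin n → ℝ := fun i => choquetQuantile (v i) (Y i) + ε / n
  have hy : ∑ i, y i = ∑ i, choquetQuantile (v i) (Y i) + ε := by
    simp only [y, Finset.sum_add_distrib, Finset.sum_const, Finset.card_univ, Fintype.card_fin,
      nsmul_eq_mul]
    rw [mul_div_cancel₀ _ hn'.ne']
  rw [← hy]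
  refine csInf_le (bddBelow_nullUnions_levels huniv hM) ?_
  refine mem_nullUnions_of_subset hv (measurableSet_lt measurable_const hX) ?_
    ⟨fun i => {ω | y i ≤ Y i ω}, fun i => measurableSet_le measurable_const (hY i),
      fun i => ?_, rfl⟩
  · intro ω hω
    by_contra hcon
    simp only [mem_iUnion, mem_ofPred_eq, not_exists, not_le] at hcon hω
    have := Finset.sum_le_sum fun i (_ : i ∈ Finset.univ) => (hcon i).le
    rw [hsum] at this
    linarith
  · obtain ⟨K, hK⟩ := hYb i
    exact (hv i).null_of_choquetQuantile_lt (hY i) hK (lt_add_of_pos_right _ (div_pos hε hn'))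

theorem IsBinaryCapacity.choquetQuantile_indicator_le {w : Set Ω → ℝ} (hw : IsBinaryCapacity w)
    {X : Ω → ℝ} (hX : Measurable X) {M : ℝ} (hM : ∀ ω, |X ω| ≤ M) {A : Set Ω}
    (hA : MeasurableSet A) {a : ℝ} (h0 : w (A ∩ {ω | a < X ω}) = 0) (b : ℝ) :
    choquetQuantile w (fun ω => A.indicator (fun ω' => X ω' - a) ω + b) ≤ b := by
  refine hw.choquetQuantile_le (abs_indicator_sub_add_le hM A a b) fun x hx => ?_
  refine hw.null_of_subset (measurableSet_le measurable_const
    (((hX.sub_const a).indicator hA).add_const b))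
    (hA.inter (measurableSet_lt measurable_const hX)) (fun ω hω => ?_) h0
  simp only [mem_ofPred_eq] at hω
  by_cases h : ω ∈ A
  · rw [indicator_of_mem h] at hω
    exact ⟨h, by simp only [mem_ofPred_eq]; linarith⟩
  · rw [indicator_of_notMem h] at hω
    linarith

end ChoquetQuantile

/-- Existence and optimality of the allocation
`X_i* = (X - x*)·1_{A_i*} + x*/n` for the inf-convolution of Choquet quantiles, when
`Ω ∉ C`, `C` is closed from below, and `x* = inf {x | {X > x} ∈ C}`. -/
theorem optimal_allocation_choquetQuantiles {Ω : Type*} [MeasurableSpace Ω]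
    (n : ℕ) (hn : 0 < n)
    (v : Fin n → Set Ω → ℝ) (hv : ∀ i, IsBinaryCapacity (v i))
    (C : Set (Set Ω))
    (hC : C = {A : Set Ω | ∃ As : Fin n → Set Ω,
      (∀ i, MeasurableSet (As i)) ∧ (∀ i, v i (As i) = 0) ∧ A = ⋃ i, As i})
    (huniv : (Set.univ : Set Ω) ∉ C)
    (hclosed : ∀ A : ℕ → Set Ω, (∀ j, A j ∈ C) → Monotone A → (⋃ j, A j) ∈ C)
    (X : Ω → ℝ) (hX : Measurable X) (hXb : ∃ M : ℝ, ∀ ω, |X ω| ≤ M)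
    (xstar : ℝ) (hxstar : xstar = sInf {x : ℝ | {ω | x < X ω} ∈ C}) :
    (∃ As : Fin n → Set Ω,
      (∀ i, MeasurableSet (As i)) ∧
      Pairwise (Function.onFun Disjoint As) ∧
      (⋃ i, As i) = Set.univ ∧
      (∀ i, v i (As i ∩ {ω | xstar < X ω}) = 0)) ∧
    (∀ As : Fin n → Set Ω,
      (∀ i, MeasurableSet (As i)) →
      Pairwise (Function.onFun Disjoint As) →
      (⋃ i, As i) = Set.univ →
      (∀ i, v i (As i ∩ {ω | xstar < X ω}) = 0) →
      (∑ i, choquetQuantile (v i)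
          (fun ω => (As i).indicator (fun ω' => X ω' - xstar) ω + xstar / n)) = xstar) ∧
    sInf {y : ℝ | ∃ Xs : Fin n → Ω → ℝ,
        (∀ i, Measurable (Xs i)) ∧ (∀ i, ∃ M : ℝ, ∀ ω, |Xs i ω| ≤ M) ∧
        (∀ ω, ∑ i, Xs i ω = X ω) ∧
        y = ∑ i, choquetQuantile (v i) (Xs i)} = xstar := by
  obtain ⟨M, hM⟩ := hXb
  have hCv : C = nullUnions v := hC
  subst hCv
  have hn' : (n : ℝ) ≠ 0 := Nat.cast_ne_zero.2 hn.ne'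
  have hlower : ∀ Y : Fin n → Ω → ℝ, (∀ i, Measurable (Y i)) →
      (∀ i, ∃ M : ℝ, ∀ ω, |Y i ω| ≤ M) → (∀ ω, ∑ i, Y i ω = X ω) →
      xstar ≤ ∑ i, choquetQuantile (v i) (Y i) := fun Y hY hYb hsum =>
    hxstar ▸ sInf_level_le_sum_choquetQuantile hv hn huniv hX hM hY hYb hsum
  have hlevel : {ω | xstar < X ω} ∈ nullUnions v :=
    hxstar ▸ level_sInf_mem_nullUnions hv hclosed hX hM
  have hconst : ∑ _i : Fin n, xstar / n = xstar := by
    simp only [Finset.sum_const, Finset.card_univ, Fintype.card_fin, nsmul_eq_mul]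
    exact mul_div_cancel₀ _ hn'
  have hmeas : ∀ As : Fin n → Set Ω, (∀ i, MeasurableSet (As i)) → ∀ i, Measurable
      (fun ω => (As i).indicator (fun ω' => X ω' - xstar) ω + xstar / n) := fun As hAs i =>
    ((hX.sub_const xstar).indicator (hAs i)).add_const _
  have hsum : ∀ As : Fin n → Set Ω, Pairwise (Function.onFun Disjoint As) →
      (⋃ i, As i) = Set.univ → ∀ ω,
      ∑ i, ((As i).indicator (fun ω' => X ω' - xstar) ω + xstar / n) = X ω :=
    fun As hdisj hU ω => by
      rw [Finset.sum_add_distrib, sum_indicator_of_partition hdisj hU, hconst, sub_add_cancel]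
  have hopt : ∀ As : Fin n → Set Ω, (∀ i, MeasurableSet (As i)) →
      Pairwise (Function.onFun Disjoint As) → (⋃ i, As i) = Set.univ →
      (∀ i, v i (As i ∩ {ω | xstar < X ω}) = 0) →
      (∑ i, choquetQuantile (v i)
        (fun ω => (As i).indicator (fun ω' => X ω' - xstar) ω + xstar / n)) = xstar := by
    intro As hAs hdisj hU h0
    refine le_antisymm ?_ (hlower _ (hmeas As hAs)
      (fun i => ⟨_, abs_indicator_sub_add_le hM (As i) xstar _⟩) (hsum As hdisj hU))
    refine (Finset.sum_le_sum fun i _ => ?_).trans_eq hconst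
    exact (hv i).choquetQuantile_indicator_le hX hM (hAs i) (h0 i) _
  have hpart := exists_partition_of_mem_nullUnions hv hn hlevel
  refine ⟨hpart, hopt, IsLeast.csInf_eq ⟨?_, ?_⟩⟩
  · obtain ⟨As, hAs, hdisj, hU, h0⟩ := hpart
    exact ⟨_, hmeas As hAs, fun i => ⟨_, abs_indicator_sub_add_le hM (As i) xstar _⟩,
      hsum As hdisj hU, (hopt As hAs hdisj hU h0).symm⟩
  · rintro y ⟨Y, hY, hYb, hYsum, rfl⟩
    exact hlower Y hY hYb hYsum
end

section
/- Let (Ω, F) be a measurable space, w a capacity on (Ω, F), α ∈ (0,1), and X : Ω → ℝ bounded and F-measurable. Define g : ℝ → ℝ by g(x) = x + (1/α) ∫_x^∞ w({ω : X(ω) > y}) dy (the integrand is monotone in y and vanishes for y ≥ sup X, so the integral is well defined). Then: (a) the set of global minimizers of g over ℝ is exactly the closed interval [VaR^w_α(X), V̄aR^w_α(X)], where VaR^w_α(X) = inf{x ∈ ℝ : w({X ≥ x}) ≤ α} and V̄aR^w_α(X) = inf{x ∈ ℝ : w({X ≥ x}) < α}; and (b) min_{x ∈ ℝ} g(x) =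 ES^w_α(X). -/
open MeasureTheory Set

/-- The Value-at-Risk of level `t` under a capacity `w`:
`VaR^w_t (X) = inf {x | w {X ≥ x} ≤ t}`. -/
noncomputable def VaRc {Ω : Type*} [MeasurableSpace Ω]
    (w : Set Ω → ℝ) (t : ℝ) (X : Ω → ℝ) : ℝ :=
  sInf {x : ℝ | w {ω | x ≤ X ω} ≤ t}

/-- The upper Value-at-Risk of level `t` under a capacity `w`:
`V̄aR^w_t (X) = inf {x | w {X ≥ x} < t}`. -/
noncomputable def upperVaRc {Ω : Type*} [MeasurableSpace Ω]
    (w : Set Ω → ℝ) (t : ℝ) (X : Ω → ℝ) : ℝ :=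
  sInf {x : ℝ | w {ω | x ≤ X ω} < t}

/-- An antitone function vanishing beyond `M` is integrable on every right half-line. -/
theorem Antitone.integrableOn_Ioi_of_eq_zero {G : ℝ → ℝ} (hG : Antitone G) {M : ℝ}
    (hM : ∀ y, M < y → G y = 0) (x : ℝ) : IntegrableOn G (Ioi x) := by
  have hc : IntegrableOn G (Icc x M) := hG.locallyIntegrable.integrableOn_isCompact isCompact_Icc
  have h0 : IntegrableOn G (Ioi M) :=
    (integrableOn_congr_fun (g := fun _ => (0 : ℝ)) (fun y hy => hM y hy)
      measurableSet_Ioi).2 integrableOn_zero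
  refine (hc.union h0).mono_set fun y hy => ?_
  rcases le_or_gt y M with h | h
  · exact Or.inl ⟨le_of_lt hy, h⟩
  · exact Or.inr h

theorem setIntegral_Ioi_le_add_of_le {G : ℝ → ℝ} {x y c : ℝ} (hG : IntegrableOn G (Ioi x))
    (hxy : x ≤ y) (h : ∀ z ∈ Ioo x y, G z ≤ c) :
    ∫ z in Ioi x, G z ≤ (∫ z in Ioi y, G z) + c * (y - x) := by
  have h1 := intervalIntegral.integral_Ioi_sub_Ioi hG hxy
  have hi : IntervalIntegrable G volume x y :=
    (intervalIntegrable_iff_integrableOn_Ioc_of_le hxy).2 (hG.mono_set Ioc_subset_Ioi_self)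
  have h2 := intervalIntegral.integral_mono_on_of_le_Ioo hxy hi
    (intervalIntegrable_const (μ := volume) (c := c)) h
  rw [intervalIntegral.integral_const, smul_eq_mul] at h2
  linarith

theorem add_le_setIntegral_Ioi_of_le {G : ℝ → ℝ} {x y c : ℝ} (hG : IntegrableOn G (Ioi x))
    (hxy : x ≤ y) (h : ∀ z ∈ Ioo x y, c ≤ G z) :
    (∫ z in Ioi y, G z) + c * (y - x) ≤ ∫ z in Ioi x, G z := by
  have h1 := intervalIntegral.integral_Ioi_sub_Ioi hG hxy
  have hi : IntervalIntegrable G volume x y :=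
    (intervalIntegrable_iff_integrableOn_Ioc_of_le hxy).2 (hG.mono_set Ioc_subset_Ioi_self)
  have h2 := intervalIntegral.integral_mono_on_of_le_Ioo hxy
    (intervalIntegrable_const (μ := volume) (c := c)) hi h
  rw [intervalIntegral.integral_const, smul_eq_mul] at h2
  linarith

/-- The minimizers of `x ↦ x + α⁻¹ ∫_x^∞ G` are the `α`-level points of `G`. -/
theorem setOf_minimizers_add_tail_eq_Icc {G : ℝ → ℝ} (hG : Antitone G)
    (hint : ∀ x, IntegrableOn G (Ioi x)) {α q Q : ℝ} (hα : 0 < α)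
    (hltq : ∀ y, y < q → α < G y) (hgtq : ∀ y, q < y → G y ≤ α)
    (hltQ : ∀ y, y < Q → α ≤ G y) (hgtQ : ∀ y, Q < y → G y < α) :
    {x : ℝ | ∀ y : ℝ, x + (1 / α) * ∫ z in Ioi x, G z ≤ y + (1 / α) * ∫ z in Ioi y, G z}
      = Icc q Q := by
  have key : ∀ x y : ℝ, (x + (1 / α) * ∫ z in Ioi x, G z ≤ y + (1 / α) * ∫ z in Ioi y, G z) ↔
      α * x + ∫ z in Ioi x, G z ≤ α * y + ∫ z in Ioi y, G z := by
    intro x y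
    rw [← mul_le_mul_iff_right₀ hα]
    simp only [mul_add, ← mul_assoc, mul_one_div_cancel hα.ne', one_mul]
  simp only [key]
  ext x
  simp only [mem_ofPred_eq, mem_Icc]
  constructor
  · intro h
    constructor
    · by_contra! hx
      obtain ⟨y, hxy, hyq⟩ := exists_between hx
      have h1 := add_le_setIntegral_Ioi_of_le (hint x) hxy.le (c := G y)
        fun z hz => hG hz.2.le
      nlinarith [h y, mul_pos (sub_pos.2 (hltq y hyq)) (sub_pos.2 hxy)]
    · by_contra! hx
      obtain ⟨y, hQy, hyx⟩ := exists_between hx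
      have h1 := setIntegral_Ioi_le_add_of_le (hint y) hyx.le (c := G y)
        fun z hz => hG hz.1.le
      nlinarith [h y, mul_pos (sub_pos.2 (hgtQ y hQy)) (sub_pos.2 hyx)]
  · rintro ⟨hqx, hxQ⟩ y
    rcases le_total x y with hxy | hyx
    · have h1 := setIntegral_Ioi_le_add_of_le (hint x) hxy
        fun z hz => hgtq z (hqx.trans_lt hz.1)
      linarith
    · have h1 := add_le_setIntegral_Ioi_of_le (hint y) hyx
        fun z hz => hltQ z (hz.2.trans_le hxQ)
      linarith

/-- The area between level `0` and level `α` under the graph of an antitone function `G`,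
computed with a generalized inverse `V` of `G`. -/
theorem intervalIntegral_generalizedInverse {G V : ℝ → ℝ} (hG : Antitone G) (hG0 : ∀ y, 0 ≤ G y)
    {M : ℝ} (hM : ∀ y, M < y → G y = 0) {α : ℝ} (hα : 0 < α) (hV : AntitoneOn V (Icc 0 α))
    (hlt : ∀ t ∈ Icc 0 α, ∀ y, y < V t → t < G y)
    (hle : ∀ t ∈ Icc 0 α, ∀ y, t < G y → y ≤ V t) :
    ∫ t in (0 : ℝ)..α, V t = α * V α + ∫ y in Ioi (V α), G y := by
  set q := V α
  have hαmem : α ∈ Icc 0 α := ⟨hα.le, le_rfl⟩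
  have hVint : IntervalIntegrable V volume 0 α :=
    AntitoneOn.intervalIntegrable (by rwa [uIcc_of_le hα.le])
  have hfint : IntegrableOn (fun t => V t - q) (Ioc 0 α) :=
    (intervalIntegrable_iff_integrableOn_Ioc_of_le hα.le).1
      (hVint.sub intervalIntegrable_const)
  have hf0 : 0 ≤ᵐ[volume.restrict (Ioc 0 α)] fun t => V t - q := by
    filter_upwards [ae_restrict_mem measurableSet_Ioc] with t ht
    exact sub_nonneg.2 (hV ⟨ht.1.le, ht.2⟩ hαmem ht.2)
  have hGq : Antitone fun s => G (q + s) := fun a b hab => hG (by linarith)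
  have hGint : IntegrableOn (fun s => G (q + s)) (Ioi 0) :=
    hGq.integrableOn_Ioi_of_eq_zero (M := M - q) (fun y hy => hM _ (by linarith)) 0
  have hshift : ∫ s in Ioi (0 : ℝ), G (q + s) = ∫ y in Ioi q, G y := by
    have := (measurePreserving_add_left volume q).setIntegral_preimage_emb
      (measurableEmbedding_addLeft q) G (Ioi q)
    rwa [preimage_const_add_Ioi, sub_self] at this
  have hlay : ENNReal.ofReal (∫ t in Ioc 0 α, (V t - q)) =
      ENNReal.ofReal (∫ s in Ioi (0 : ℝ), G (q + s)) := by
    rw [ofReal_integral_eq_lintegral_ofReal hfint hf0,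
      ofReal_integral_eq_lintegral_ofReal hGint (ae_of_all _ fun s => hG0 _)]
    apply le_antisymm
    · rw [lintegral_eq_lintegral_meas_lt _ hf0 hfint.aemeasurable]
      refine lintegral_mono fun s => ?_
      rw [Measure.restrict_apply' measurableSet_Ioc]
      calc volume ({t | s < V t - q} ∩ Ioc 0 α) ≤ volume (Ioo 0 (G (q + s))) := by
            refine measure_mono fun t ht => ⟨ht.2.1, hlt t ⟨ht.2.1.le, ht.2.2⟩ _ ?_⟩
            have : s < V t - q := ht.1
            linarith
        _ = ENNReal.ofReal (G (q + s)) := by rw [Real.volume_Ioo, sub_zero]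
    · rw [lintegral_eq_lintegral_meas_le _ hf0 hfint.aemeasurable]
      refine setLIntegral_mono' measurableSet_Ioi fun s hs => ?_
      rw [Measure.restrict_apply' measurableSet_Ioc]
      have hGα : G (q + s) ≤ α := by
        by_contra! h
        have := hle α hαmem _ h
        have : 0 < s := hs
        linarith
      calc ENNReal.ofReal (G (q + s)) = volume (Ioo 0 (G (q + s))) := by
            rw [Real.volume_Ioo, sub_zero]
        _ ≤ volume ({t | s ≤ V t - q} ∩ Ioc 0 α) := by
            refine measure_mono fun t ht => ?_
            have htα : t ≤ α := ht.2.le.trans hGα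
            have := hle t ⟨ht.1.le, htα⟩ _ ht.2
            exact ⟨show s ≤ V t - q by linarith, ht.1, htα⟩
  rw [ENNReal.ofReal_eq_ofReal_iff (integral_nonneg_of_ae hf0)
    (integral_nonneg fun s => hG0 _), hshift, ← intervalIntegral.integral_of_le hα.le,
    intervalIntegral.integral_sub hVint intervalIntegrable_const,
    intervalIntegral.integral_const, smul_eq_mul] at hlay
  linarith

section Capacity

variable {Ω : Type*} [MeasurableSpace Ω] {w : Set Ω → ℝ} {X : Ω → ℝ} {M : ℝ}

theorem IsCapacity.nonneg (hw : IsCapacity w) {A : Set Ω} (hA : MeasurableSet A) : 0 ≤ w A :=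
  hw.1 ▸ hw.2.2 MeasurableSet.empty hA (empty_subset A)

theorem IsCapacity.antitone_lt (hw : IsCapacity w) (hX : Measurable X) :
    Antitone fun y => w {ω | y < X ω} := fun _ _ hab =>
  hw.2.2 (measurableSet_lt measurable_const hX) (measurableSet_lt measurable_const hX)
    fun _ hω => lt_of_le_of_lt hab hω

theorem IsCapacity.lt_le_le (hw : IsCapacity w) (hX : Measurable X) (y : ℝ) :
    w {ω | y < X ω} ≤ w {ω | y ≤ X ω} :=
  hw.2.2 (measurableSet_lt measurable_const hX) (measurableSet_le measurable_const hX)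
    (ofPred_subset_ofPred.2 fun _ => le_of_lt)

theorem IsCapacity.le_le_lt (hw : IsCapacity w) (hX : Measurable X) {y z : ℝ} (h : y < z) :
    w {ω | z ≤ X ω} ≤ w {ω | y < X ω} :=
  hw.2.2 (measurableSet_le measurable_const hX) (measurableSet_lt measurable_const hX)
    fun _ hω => lt_of_lt_of_le h hω

theorem IsCapacity.le_eq_zero (hw : IsCapacity w) (hM : ∀ ω, |X ω| ≤ M) {y : ℝ} (hy : M < y) :
    w {ω | y ≤ X ω} = 0 := by
  rw [← hw.1]
  congr 1
  ext ω
  simpa using ((abs_le.1 (hM ω)).2.trans_lt hy)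

theorem IsCapacity.le_eq_one (hw : IsCapacity w) (hM : ∀ ω, |X ω| ≤ M) {y : ℝ} (hy : y ≤ -M) :
    w {ω | y ≤ X ω} = 1 := by
  rw [← hw.2.1]
  congr 1
  ext ω
  simpa using hy.trans (abs_le.1 (hM ω)).1

theorem IsCapacity.bddBelow_le (hw : IsCapacity w) (hM : ∀ ω, |X ω| ≤ M) {t : ℝ} (ht : t < 1) :
    BddBelow {x : ℝ | w {ω | x ≤ X ω} ≤ t} := by
  refine ⟨-M, fun x hx => ?_⟩
  by_contra! h
  have hx' : w {ω | x ≤ X ω} ≤ t := hx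
  rw [hw.le_eq_one hM h.le] at hx'
  linarith

theorem IsCapacity.nonempty_lt (hw : IsCapacity w) (hM : ∀ ω, |X ω| ≤ M) {t : ℝ} (ht : 0 < t) :
    {x : ℝ | w {ω | x ≤ X ω} < t}.Nonempty :=
  ⟨M + 1, (hw.le_eq_zero hM (lt_add_one M)).trans_lt ht⟩

theorem IsCapacity.nonempty_le (hw : IsCapacity w) (hM : ∀ ω, |X ω| ≤ M) {t : ℝ} (ht : 0 ≤ t) :
    {x : ℝ | w {ω | x ≤ X ω} ≤ t}.Nonempty :=
  ⟨M + 1, (hw.le_eq_zero hM (lt_add_one M)).trans_le ht⟩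

theorem IsCapacity.lt_of_lt_VaRc (hw : IsCapacity w) (hX : Measurable X)
    (hM : ∀ ω, |X ω| ≤ M) {t y : ℝ} (ht : t < 1) (hy : y < VaRc w t X) :
    t < w {ω | y < X ω} := by
  obtain ⟨z, hyz, hz⟩ := exists_between hy
  have h : t < w {ω | z ≤ X ω} :=
    not_le.1 fun h => notMem_of_lt_csInf hz (hw.bddBelow_le hM ht) h
  exact h.trans_le (hw.le_le_lt hX hyz)

theorem IsCapacity.le_VaRc_of_lt (hw : IsCapacity w) (hX : Measurable X)
    (hM : ∀ ω, |X ω| ≤ M) {t y : ℝ} (ht : 0 ≤ t) (hy : t < w {ω | y < X ω}) :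
    y ≤ VaRc w t X := by
  refine le_csInf (hw.nonempty_le hM ht) fun x hx => ?_
  by_contra! h
  have hx' : w {ω | x ≤ X ω} ≤ t := hx
  linarith [hw.antitone_lt hX h.le, hw.lt_le_le hX x]

theorem IsCapacity.le_of_lt_upperVaRc (hw : IsCapacity w) (hX : Measurable X)
    (hM : ∀ ω, |X ω| ≤ M) {t y : ℝ} (ht : t < 1) (hy : y < upperVaRc w t X) :
    t ≤ w {ω | y < X ω} := by
  obtain ⟨z, hyz, hz⟩ := exists_between hy
  have h : t ≤ w {ω | z ≤ X ω} :=
    not_lt.1 fun h => notMem_of_lt_csInf hz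
      ((hw.bddBelow_le hM ht).mono (ofPred_subset_ofPred.2 fun _ => le_of_lt)) h
  exact h.trans (hw.le_le_lt hX hyz)

theorem IsCapacity.lt_of_upperVaRc_lt (hw : IsCapacity w) (hX : Measurable X)
    (hM : ∀ ω, |X ω| ≤ M) {t y : ℝ} (ht : 0 < t) (hy : upperVaRc w t X < y) :
    w {ω | y < X ω} < t := by
  obtain ⟨z, hz, hzy⟩ := exists_lt_of_csInf_lt (hw.nonempty_lt hM ht) hy
  exact ((hw.antitone_lt hX hzy.le).trans (hw.lt_le_le hX z)).trans_lt hz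

theorem IsCapacity.VaRc_le_upperVaRc (hw : IsCapacity w) (hM : ∀ ω, |X ω| ≤ M) {t : ℝ}
    (ht : t ∈ Ioo (0 : ℝ) 1) : VaRc w t X ≤ upperVaRc w t X :=
  csInf_le_csInf (hw.bddBelow_le hM ht.2) (hw.nonempty_lt hM ht.1)
    (ofPred_subset_ofPred.2 fun _ => le_of_lt)

theorem IsCapacity.antitoneOn_VaRc (hw : IsCapacity w) (hM : ∀ ω, |X ω| ≤ M) :
    AntitoneOn (fun t => VaRc w t X) (Ico 0 1) := fun _ ha _ hb hab =>
  csInf_le_csInf (hw.bddBelow_le hM hb.2) (hw.nonempty_le hM ha.1) fun _ hx => le_trans hx hab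

end Capacity

/-- Rockafellar–Uryasev type formula for Choquet quantiles and Choquet Expected
Shortfall: for `g x = x + (1/α) ∫_x^∞ w {X > y} dy`, the set of global minimizers of `g`
is exactly `[VaR^w_α(X), V̄aR^w_α(X)]`, and the minimum value of `g` is
`ES^w_α(X) = (1/α) ∫_0^α VaR^w_t(X) dt`. -/
theorem RU_formula_choquet {Ω : Type*} [MeasurableSpace Ω]
    (w : Set Ω → ℝ) (hw : IsCapacity w)
    (α : ℝ) (hα : α ∈ Set.Ioo (0 : ℝ) 1)
    (X : Ω → ℝ) (hX : Measurable X) (hXb : ∃ M : ℝ, ∀ ω, |X ω| ≤ M)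
    (g : ℝ → ℝ)
    (hg : g = fun x => x + (1 / α) * ∫ y in Set.Ioi x, w {ω | y < X ω}) :
    {x : ℝ | ∀ y : ℝ, g x ≤ g y} = Set.Icc (VaRc w α X) (upperVaRc w α X) ∧
    IsLeast (Set.range g) ((1 / α) * ∫ t in (0 : ℝ)..α, VaRc w t X) := by
  obtain ⟨M, hM⟩ := hXb
  have hanti := hw.antitone_lt hX
  have hnonneg : ∀ y, 0 ≤ w {ω | y < X ω} := fun y =>
    hw.nonneg (measurableSet_lt measurable_const hX)
  have hzero : ∀ y, M < y → w {ω | y < X ω} = 0 := fun y hy =>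
    le_antisymm ((hw.lt_le_le hX y).trans_eq (hw.le_eq_zero hM hy)) (hnonneg y)
  have hmin : {x : ℝ | ∀ y : ℝ, g x ≤ g y} = Icc (VaRc w α X) (upperVaRc w α X) := by
    subst hg
    exact setOf_minimizers_add_tail_eq_Icc hanti (hanti.integrableOn_Ioi_of_eq_zero hzero) hα.1
      (fun y => hw.lt_of_lt_VaRc hX hM hα.2)
      (fun y hy => not_lt.1 fun h => hy.not_ge (hw.le_VaRc_of_lt hX hM hα.1.le h))
      (fun y => hw.le_of_lt_upperVaRc hX hM hα.2)
      (fun y => hw.lt_of_upperVaRc_lt hX hM hα.1)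
  have hES : (1 / α) * ∫ t in (0 : ℝ)..α, VaRc w t X = g (VaRc w α X) := by
    rw [intervalIntegral_generalizedInverse hanti hnonneg hzero hα.1
      ((hw.antitoneOn_VaRc hM).mono fun t ht => ⟨ht.1, ht.2.trans_lt hα.2⟩)
      (fun t ht y => hw.lt_of_lt_VaRc hX hM (ht.2.trans_lt hα.2))
      (fun t ht y => hw.le_VaRc_of_lt hX hM ht.1), hg, mul_add, ← mul_assoc,
      one_div_mul_cancel hα.1.ne', one_mul]
  refine ⟨hmin, ?_⟩
  have hmem : VaRc w α X ∈ {x : ℝ | ∀ y : ℝ, g x ≤ g y} :=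
    hmin ▸ left_mem_Icc.2 (hw.VaRc_le_upperVaRc hM hα)
  rw [hES]
  exact ⟨mem_range_self _, forall_mem_range.2 hmem⟩
end
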